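/- (Theorem 5.2, full characterization of G-homotopic primitive 6-cycles.) Let n ≥ 2, let 0 ≤ i ≤ n−3, and let σ, γ ∈ Equiv.Perm (Fin n). The following are equivalent: (1) there exist words u, v over {0,…,n−2} with π(u) = σ, π(v) = γ, and u ++ c_i ++ reverse(u) ≈ v ++ c_i ++ reverse(v); (2) σ⁻¹γ belongs to the subgroup of Equiv.Perm (Fin n) generated by the element s_i·s_{i+1} together with all adjacent transpositions s_m disjoint from s_i and s_{i+1} (i.e., with m ≤ i−2 or m ≥ i+3). -/

import Mathlib

/-- The adjacent transposition `s_j = (j, j+1)` in the symmetric group on `Fin n`,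
indexed by `j : Fin (n-1)`. -/
def s {n : ℕ} (j : Fin (n - 1)) : Equiv.Perm (Fin n) :=
  Equiv.swap ⟨j.val, by have := j.isLt; omega⟩ ⟨j.val + 1, by have := j.isLt; omega⟩

/-- `π` sends a word `[j₁, …, j_r]` over the alphabet `{0, …, n-2}` to the product
`s_{j₁} ⋯ s_{j_r}`. -/
def π {n : ℕ} (w : List (Fin (n - 1))) : Equiv.Perm (Fin n) :=
  (w.map s).prod

/-- The two elementary moves on words: (T2) insertion of a square `[j, j]`, and
(T3) commutation of two letters `j, k` with `|j - k| ≥ 2`. -/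
inductive Move {n : ℕ} : List (Fin (n - 1)) → List (Fin (n - 1)) → Prop
  | t2 (u v : List (Fin (n - 1))) (j : Fin (n - 1)) :
      Move (u ++ v) (u ++ [j, j] ++ v)
  | t3 (u v : List (Fin (n - 1))) (j k : Fin (n - 1))
      (h : j.val + 2 ≤ k.val ∨ k.val + 2 ≤ j.val) :
      Move (u ++ [j, k] ++ v) (u ++ [k, j] ++ v)

/-- The equivalence `≈` on words: the reflexive–symmetric–transitive closure of the
moves (T2) and (T3). -/
def WEquiv {n : ℕ} : List (Fin (n - 1)) → List (Fin (n - 1)) → Prop :=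
  Relation.EqvGen Move

/-- The word `c_i = [i, i+1, i, i+1, i, i+1]` labelling a primitive 6-cycle of the
permutahedron graph, defined for `i + 3 ≤ n` (i.e. `0 ≤ i ≤ n-3`). -/
def cword {n : ℕ} (i : ℕ) (hi : i + 3 ≤ n) : List (Fin (n - 1)) :=
  [⟨i, by omega⟩, ⟨i + 1, by omega⟩, ⟨i, by omega⟩,
   ⟨i + 1, by omega⟩, ⟨i, by omega⟩, ⟨i + 1, by omega⟩]


namespace RAC

/-! ### An amalgamated double of a group -/

theorem exists_double {A : Type} [Group A] (K : Subgroup A) (x : A) (hx : x ∉ K) :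
    ∃ (E : Type) (_ : Group E) (f g : A →* E), (∀ k ∈ K, f k = g k) ∧
      ∀ qs : List A, qs ≠ [] → (∀ q ∈ qs, q ∉ K) →
        (qs.map (fun q => f q * g x)).prod ≠ 1 := by
  classical
  let φ : ∀ _ : Bool, K →* A := fun _ => K.subtype
  refine ⟨Monoid.PushoutI φ, inferInstance, Monoid.PushoutI.of (φ := φ) true,
    Monoid.PushoutI.of (φ := φ) false, ?_, ?_⟩
  · intro k hk
    have h1 := Monoid.PushoutI.of_apply_eq_base φ true ⟨k, hk⟩
    have h2 := Monoid.PushoutI.of_apply_eq_base φ false ⟨k, hk⟩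
    exact h1.trans h2.symm
  · intro qs hne hq hprod
    let L : List A → List (Σ _ : Bool, A) :=
      fun qs => qs.flatMap (fun q => [⟨true, q⟩, ⟨false, x⟩])
    have hLmem : ∀ l ∈ L qs, l.2 ∉ K := by
      intro l hl
      simp only [L, List.mem_flatMap] at hl
      obtain ⟨q, hqm, hl⟩ := hl
      simp only [List.mem_cons, List.not_mem_nil, or_false] at hl
      rcases hl with rfl | rfl
      · exact hq q hqm
      · exact hx
    have hchain : ∀ qs : List A, (L qs).IsChain (fun l l' => l.1 ≠ l'.1) := by
      intro qs
      induction qs with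
      | nil => simp [L]
      | cons q qs ih =>
        cases qs with
        | nil => simp [L]
        | cons r rs =>
          simp only [L, List.flatMap_cons, List.cons_append, List.nil_append,
            List.isChain_cons_cons] at ih ⊢
          refine ⟨by simp, by simp, ih⟩
    let w : Monoid.CoprodI.Word (fun _ : Bool => A) :=
      { toList := L qs
        ne_one := fun l hl h => hLmem l hl (by rw [h]; exact K.one_mem)
        chain_ne := hchain qs }
    have hred : Monoid.PushoutI.Reduced φ w := by
      intro g hg
      have := hLmem g hg
      simpa [φ] using this
    have hp : ∀ qs : List A, Monoid.PushoutI.ofCoprodI (φ := φ)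
        (List.prod ((L qs).map fun l => Monoid.CoprodI.of (M := fun _ : Bool => A) (i := l.fst) l.snd)) =
        (qs.map (fun q => Monoid.PushoutI.of (φ := φ) true q *
          Monoid.PushoutI.of (φ := φ) false x)).prod := by
      intro qs
      induction qs with
      | nil => simp [L]
      | cons q qs ih =>
        have : L (q :: qs) = ⟨true, q⟩ :: ⟨false, x⟩ :: L qs := rfl
        rw [this]
        simp only [List.map_cons, List.prod_cons, map_mul, ih,
          Monoid.PushoutI.ofCoprodI_of, mul_assoc]
    have hw : w = .empty := by
      apply hred.eq_empty_of_mem_range (fun _ => K.subtype_injective)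
      have : Monoid.PushoutI.ofCoprodI (φ := φ) w.prod = 1 := (hp qs).trans hprod
      rw [this]
      exact one_mem _
    have : L qs = [] := congrArg Monoid.CoprodI.Word.toList hw
    cases qs with
    | nil => exact hne rfl
    | cons q qs => simp [L] at this

theorem inv_prod_mul {A E : Type} [Group A] [Group E] (f : A →* E) (X : E) (hX : X * X = 1)
    (qs : List A) :
    ((qs.map (fun q => f q * X)).prod)⁻¹ * X =
      X * ((qs.reverse.map (fun q => q⁻¹)).map (fun q => f q * X)).prod := by
  have hX' : X⁻¹ = X := inv_eq_of_mul_eq_one_left hX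
  induction qs with
  | nil => simp
  | cons q qs ih =>
    simp only [List.map_cons, List.prod_cons, List.reverse_cons, List.map_append,
      List.prod_append, mul_inv_rev, List.map_nil, List.prod_nil, mul_one, hX', map_inv]
    rw [← mul_assoc X, ← ih]
    simp only [mul_assoc]

/-! ### The right-angled Coxeter group -/

variable {n : ℕ}

/-- Letters that commute. -/
def Far (j k : Fin (n - 1)) : Prop := j.val + 2 ≤ k.val ∨ k.val + 2 ≤ j.val

/-- Relators. -/
def rels (n : ℕ) : Set (FreeGroup (Fin (n - 1))) :=
  {r | ∃ j, r = FreeGroup.of j * FreeGroup.of j} ∪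
  {r | ∃ j k, Far j k ∧
    r = FreeGroup.of j * FreeGroup.of k * (FreeGroup.of k * FreeGroup.of j)⁻¹}

/-- The right-angled Coxeter group. -/
abbrev A (n : ℕ) : Type := PresentedGroup (rels n)

/-- Generators. -/
def gen (j : Fin (n - 1)) : A n := PresentedGroup.of j

theorem gen_sq (j : Fin (n - 1)) : gen j * gen j = 1 :=
  PresentedGroup.one_of_mem (rels := rels n) (Or.inl ⟨j, rfl⟩)

theorem gen_comm {j k : Fin (n - 1)} (h : Far j k) : gen j * gen k = gen k * gen j := by
  have : gen j * gen k * (gen k * gen j)⁻¹ = 1 :=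
    PresentedGroup.one_of_mem (rels := rels n) (Or.inr ⟨j, k, h, rfl⟩)
  exact mul_inv_eq_one.1 this

theorem exists_lift {H : Type} [Group H] (f : Fin (n - 1) → H) (h2 : ∀ j, f j * f j = 1)
    (hc : ∀ j k, Far j k → f j * f k = f k * f j) :
    ∃ F : A n →* H, ∀ j, F (gen j) = f j := by
  have h : ∀ r ∈ rels n, FreeGroup.lift f r = 1 := by
    rintro r (⟨j, rfl⟩ | ⟨j, k, hjk, rfl⟩)
    · simp [h2]
    · simp only [map_mul, map_inv, FreeGroup.lift_apply_of]
      rw [hc j k hjk, mul_inv_cancel]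
  exact ⟨PresentedGroup.toGroup h, fun j => PresentedGroup.toGroup.of h⟩

/-- Value of a word. -/
def val (w : List (Fin (n - 1))) : A n := (w.map gen).prod

@[simp] theorem val_nil : val ([] : List (Fin (n - 1))) = 1 := rfl
@[simp] theorem val_cons (j : Fin (n - 1)) (w) : val (j :: w) = gen j * val w := by simp [val]
@[simp] theorem val_append (v w : List (Fin (n - 1))) : val (v ++ w) = val v * val w := by
  simp [val]

theorem gen_inv (j : Fin (n - 1)) : (gen j)⁻¹ = gen j := inv_eq_of_mul_eq_one_left (gen_sq j)

theorem val_reverse (w : List (Fin (n - 1))) : val w.reverse = (val w)⁻¹ := by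
  induction w with
  | nil => simp
  | cons j w ih => simp [ih, gen_inv]

theorem val_eq_of_wequiv {v w : List (Fin (n - 1))} (h : WEquiv v w) : val v = val w := by
  induction h with
  | rel v w h =>
    cases h with
    | t2 u v j => simp [← mul_assoc, gen_sq]
    | t3 u v j k h =>
      have : val [j, k] = val [k, j] := by simpa using gen_comm h
      rw [val_append, val_append, val_append, val_append, this]
  | refl => rfl
  | symm _ _ _ ih => exact ih.symm
  | trans _ _ _ _ _ h1 h2 => exact h1.trans h2

/-- Parity of the number of occurrences of `x`. -/
theorem exists_parity (x : Fin (n - 1)) : ∃ F : A n →* Multiplicative (ZMod 2),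
    ∀ j, F (gen j) = if j = x then Multiplicative.ofAdd 1 else 1 := by
  apply exists_lift
  · intro j
    split_ifs
    · decide
    · simp
  · intro j k _
    exact mul_comm _ _

/-- Subgroup generated by letters commuting with `x`. -/
def link (x : Fin (n - 1)) : Subgroup (A n) := Subgroup.closure {g | ∃ y, Far y x ∧ g = gen y}

theorem link_comm {x : Fin (n - 1)} {k : A n} (hk : k ∈ link x) : k * gen x = gen x * k := by
  have : link x ≤ Subgroup.centralizer {gen x} := by
    rw [link, Subgroup.closure_le]
    rintro _ ⟨y, hy, rfl⟩
    rw [SetLike.mem_coe, Subgroup.mem_centralizer_singleton_iff]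
    exact gen_comm hy
  have h := this hk
  rw [Subgroup.mem_centralizer_singleton_iff] at h
  exact h

theorem parity_link {x z : Fin (n - 1)} (hz : ¬ Far z x) (F : A n →* Multiplicative (ZMod 2))
    (hF : ∀ j, F (gen j) = if j = z then Multiplicative.ofAdd 1 else 1) {k : A n}
    (hk : k ∈ link x) : F k = 1 := by
  have : link x ≤ F.ker := by
    rw [link, Subgroup.closure_le]
    rintro _ ⟨y, hy, rfl⟩
    rw [SetLike.mem_coe, MonoidHom.mem_ker, hF, if_neg]
    rintro rfl
    exact hz hy
  exact this hk

theorem gen_not_mem_link (x : Fin (n - 1)) : gen x ∉ link x := by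
  intro h
  obtain ⟨F, hF⟩ := exists_parity x
  have h1 := parity_link (z := x) (by unfold Far; omega) F hF h
  rw [hF, if_pos rfl] at h1
  exact absurd h1 (by decide)

theorem conj_not_mem_link {x z : Fin (n - 1)} (hz : ¬ Far z x) {c : A n}
    (hc : ∀ F : A n →* Multiplicative (ZMod 2),
      (∀ j, F (gen j) = if j = z then Multiplicative.ofAdd 1 else 1) → F c ≠ 1) (h : A n) :
    h * c * h⁻¹ ∉ link x := by
  intro hk
  obtain ⟨F, hF⟩ := exists_parity z
  have h1 := parity_link hz F hF hk
  apply hc F hF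
  rw [map_mul, map_mul, mul_comm (F h), mul_assoc, ← map_mul, mul_inv_cancel] at h1
  simpa using h1

theorem split_word {x : Fin (n - 1)} {E : Type} [Group E] (f : A n →* E) (X : E)
    (Φ : A n →* E) (hX : Φ (gen x) = X) (hf : ∀ y, y ≠ x → Φ (gen y) = f (gen y)) :
    ∀ (N : ℕ) (w : List (Fin (n - 1))), w.length ≤ N →
      (∀ p h t, x :: w = p ++ x :: (h ++ x :: t) → val h ∉ link x) →
      ∃ (qs : List (A n)) (h : A n), (∀ q ∈ qs, q ∉ link x) ∧
        Φ (val w) = (qs.map (fun q => f q * X)).prod * f h := by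
  have free : ∀ w : List (Fin (n - 1)), x ∉ w → Φ (val w) = f (val w) := by
    intro w hw
    induction w with
    | nil => simp
    | cons y w ih =>
      simp only [List.mem_cons, not_or] at hw
      rw [val_cons, map_mul, map_mul, ih hw.2, hf y (Ne.symm hw.1)]
  intro N
  induction N with
  | zero =>
    intro w hw _
    have : w = [] := by simpa using hw
    subst this
    exact ⟨[], 1, by simp, by simp⟩
  | succ N ih =>
    intro w hw hmin
    by_cases hxw : x ∈ w
    · obtain ⟨h, t, rfl, hxh⟩ := List.eq_append_cons_of_mem hxw
      obtain ⟨qs, e, hqs, he⟩ := ih t (by simp at hw; omega) (by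
        intro p h' t' heq
        apply hmin (x :: h ++ p) h' t'
        rw [heq]; simp)
      refine ⟨val h :: qs, e, ?_, ?_⟩
      · intro q hq
        rcases List.mem_cons.1 hq with rfl | hq
        · exact hmin [] h t rfl
        · exact hqs q hq
      · rw [val_append, val_cons, map_mul, map_mul, he, free h hxh, hX]
        simp [mul_assoc]
    · exact ⟨[], val w, by simp, by simp [free w hxw]⟩

theorem not_mem_of_minimal {x z : Fin (n - 1)} (hz : ¬ Far z x) {c : A n}
    (hc : ∀ F : A n →* Multiplicative (ZMod 2),
      (∀ j, F (gen j) = if j = z then Multiplicative.ofAdd 1 else 1) → F c ≠ 1)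
    (hcx : ∃ cw, x ∉ cw ∧ val cw = c)
    (w : List (Fin (n - 1))) (hmin : ∀ w', val w' = val w → w.length ≤ w'.length)
    (hw : val w * c * (val w)⁻¹ = c) : x ∉ w := by
  intro hxw
  obtain ⟨E, _, f, g, hfg, hE⟩ := exists_double (link x) (gen x) (gen_not_mem_link x)
  obtain ⟨Φ, hΦ⟩ := exists_lift (n := n) (fun y => if y = x then g (gen y) else f (gen y))
    (by
      intro j
      split_ifs
      · rw [← map_mul, gen_sq, map_one]
      · rw [← map_mul, gen_sq, map_one])
    (by
      intro j k hjk
      have key : ∀ y, Far y x → f (gen y) = g (gen y) := fun y hy =>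
        hfg _ (Subgroup.subset_closure ⟨y, hy, rfl⟩)
      split_ifs with h1 h2 h2
      · rw [h1, h2]
      · subst h1
        rw [key k (Or.symm hjk), ← map_mul, ← map_mul, gen_comm hjk]
      · subst h2
        rw [key j hjk, ← map_mul, ← map_mul, gen_comm hjk]
      · rw [← map_mul, ← map_mul, gen_comm hjk])
  have hΦx : Φ (gen x) = g (gen x) := by rw [hΦ, if_pos rfl]
  have hΦy : ∀ y, y ≠ x → Φ (gen y) = f (gen y) := fun y hy => by rw [hΦ, if_neg hy]
  have free : ∀ w : List (Fin (n - 1)), x ∉ w → Φ (val w) = f (val w) := by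
    intro w hw
    induction w with
    | nil => simp
    | cons y w ih =>
      simp only [List.mem_cons, not_or] at hw
      rw [val_cons, map_mul, map_mul, ih hw.2, hΦy y (Ne.symm hw.1)]
  obtain ⟨cw, hcw, rfl⟩ := hcx
  obtain ⟨h0, w', rfl, hxh⟩ := List.eq_append_cons_of_mem hxw
  obtain ⟨qs, e, hqs, he⟩ := split_word f (g (gen x)) Φ hΦx hΦy w'.length w' le_rfl (by
    intro p h t heq hk
    have h1 := hmin (h0 ++ (p ++ (h ++ t))) (by
      rw [heq]
      simp only [val_append, val_cons]
      rw [← mul_assoc (val h), link_comm hk, mul_assoc (gen x), ← mul_assoc (gen x) (gen x),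
        gen_sq, one_mul])
    rw [heq] at h1
    simp at h1)
  set X := g (gen x) with hX
  have hXX : X * X = 1 := by rw [hX, ← map_mul, gen_sq, map_one]
  set c := val cw
  set d := (val h0)⁻¹ * c⁻¹ * ((val h0)⁻¹)⁻¹ with hd
  have hdK : d ∉ link x := by
    intro h
    apply conj_not_mem_link hz hc (val h0)⁻¹
    have := inv_mem h
    simpa [hd, mul_assoc] using this
  refine hE (qs ++ ([e * c * e⁻¹] ++ ((qs.reverse.map (fun q => q⁻¹)) ++ [d]))) (by simp) ?_ ?_
  · intro q hq
    simp only [List.mem_append, List.mem_singleton, List.mem_map, List.mem_reverse] at hq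
    rcases hq with hq | rfl | ⟨q, hq, rfl⟩ | rfl
    · exact hqs q hq
    · exact conj_not_mem_link hz hc e
    · intro h
      exact hqs q hq (by simpa using inv_mem h)
    · exact hdK
  · rw [List.map_append, List.map_append, List.map_append, List.prod_append, List.prod_append,
      List.prod_append]
    have hinv := inv_prod_mul f X hXX qs
    set Q := (qs.map (fun q => f q * X)).prod
    set R := ((qs.reverse.map (fun q => q⁻¹)).map (fun q => f q * X)).prod
    simp only [List.map_cons, List.map_nil, List.prod_cons, List.prod_nil, mul_one]
    have hcf : Φ c = f c := free cw hcw
    have h0f : Φ (val h0) = f (val h0) := free h0 hxh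
    have hX' : X⁻¹ = X := inv_eq_of_mul_eq_one_left hXX
    have hw2 := congrArg Φ hw
    simp only [val_append, val_cons, map_mul, map_inv, hΦx, he, hcf, h0f, mul_inv_rev, hX'] at hw2
    have hfd : f d = (f (val h0))⁻¹ * (f c)⁻¹ * f (val h0) := by
      simp [hd]
    have hR : X * R = Q⁻¹ * X := hinv.symm
    calc Q * (f (e * c * e⁻¹) * X * (R * (f d * X)))
        = Q * f (e * c * e⁻¹) * (X * R) * f d * X := by simp only [mul_assoc]
      _ = X⁻¹ * (f (val h0))⁻¹ * (f (val h0) * (X * (Q * f e)) * f c *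
          ((f e)⁻¹ * Q⁻¹ * X * (f (val h0))⁻¹)) * (f c)⁻¹ * f (val h0) * X := by
          rw [hR, hfd, map_mul, map_mul, map_inv]; group
      _ = 1 := by rw [hw2]; group

/-! ### Words -/

theorem WEquiv.congr {v w : List (Fin (n - 1))} (p q : List (Fin (n - 1))) (h : WEquiv v w) :
    WEquiv (p ++ v ++ q) (p ++ w ++ q) := by
  induction h with
  | rel v w h =>
    apply Relation.EqvGen.rel
    cases h with
    | t2 u v j => simpa using Move.t2 (p ++ u) (v ++ q) j
    | t3 u v j k h => simpa using Move.t3 (p ++ u) (v ++ q) j k h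
  | refl => exact Relation.EqvGen.refl _
  | symm _ _ _ ih => exact ih.symm
  | trans _ _ _ _ _ h1 h2 => exact h1.trans _ _ _ h2

theorem wequiv_reverse_append (w : List (Fin (n - 1))) : WEquiv (w.reverse ++ w) [] := by
  induction w with
  | nil => exact Relation.EqvGen.refl _
  | cons j w ih =>
    refine Relation.EqvGen.trans _ _ _ ?_ ih
    apply Relation.EqvGen.symm
    apply Relation.EqvGen.rel
    simpa using Move.t2 w.reverse w j

theorem wequiv_conj_comm (m : Fin (n - 1)) (w : List (Fin (n - 1))) (h : ∀ y ∈ w, Far m y) :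
    WEquiv ([m] ++ w ++ [m]) w := by
  induction w with
  | nil => exact Relation.EqvGen.symm _ _ (Relation.EqvGen.rel _ _ (Move.t2 [] [] m))
  | cons y w ih =>
    have h1 : WEquiv ([m] ++ (y :: w) ++ [m]) ([y] ++ ([m] ++ w ++ [m]) ++ []) := by
      apply Relation.EqvGen.rel
      simpa using Move.t3 [] (w ++ [m]) m y (h y (by simp))
    have h2 := WEquiv.congr [y] [] (ih (fun z hz => h z (by simp [hz])))
    have h3 : WEquiv _ _ := Relation.EqvGen.trans _ _ _ h1 h2
    simpa using h3

theorem s_sq (j : Fin (n - 1)) : (s j : Equiv.Perm (Fin n)) * s j = 1 := by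
  simp [s]

theorem s_comm (j k : Fin (n - 1)) (h : Far j k) :
    (s j : Equiv.Perm (Fin n)) * s k = s k * s j := by
  have hd : Equiv.Perm.Disjoint (s j : Equiv.Perm (Fin n)) (s k) := by
    intro a
    by_cases h1 : a.val = j.val ∨ a.val = j.val + 1
    · right
      unfold Far at h
      apply Equiv.swap_apply_of_ne_of_ne <;> simp [Fin.ext_iff] <;> omega
    · left
      apply Equiv.swap_apply_of_ne_of_ne <;> simp [Fin.ext_iff] <;> omega
  exact hd.commute

theorem pi_append (v w : List (Fin (n - 1))) : (π (v ++ w) : Equiv.Perm (Fin n)) = π v * π w := by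
  simp [π]

theorem pi_reverse (w : List (Fin (n - 1))) :
    (π w.reverse : Equiv.Perm (Fin n)) = (π w)⁻¹ := by
  induction w with
  | nil => simp [π]
  | cons j w ih =>
    rw [List.reverse_cons, pi_append, ih]
    have : (s j : Equiv.Perm (Fin n))⁻¹ = s j := inv_eq_of_mul_eq_one_left (s_sq j)
    simp [π, this]

theorem exists_pi (σ : Equiv.Perm (Fin n)) : ∃ w : List (Fin (n - 1)), π w = σ := by
  cases n with
  | zero => exact ⟨[], Subsingleton.elim _ _⟩
  | succ n =>
    have h : σ ∈ Submonoid.closure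
        (Set.range fun i : Fin n => Equiv.swap i.castSucc i.succ) := by
      rw [Equiv.Perm.mclosure_swap_castSucc_succ]; trivial
    induction h using Submonoid.closure_induction with
    | mem x hx =>
      obtain ⟨j, rfl⟩ := hx
      exact ⟨[j], by simp [π, s]; rfl⟩
    | one => exact ⟨[], rfl⟩
    | mul x y _ _ hx hy =>
      obtain ⟨v, rfl⟩ := hx
      obtain ⟨w, rfl⟩ := hy
      exact ⟨v ++ w, pi_append v w⟩

theorem forward (a b : Fin (n - 1)) (hab : b.val = a.val + 1) (w : List (Fin (n - 1)))
    (hP : ∀ y ∈ w, y = a ∨ y = b ∨ (Far y a ∧ Far y b)) (N : Subgroup (Equiv.Perm (Fin n)))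
    (hN : s a * s b ∈ N) (hN2 : ∀ m, Far m a → Far m b → s m ∈ N)
    (hw : val w * val [a, b, a, b, a, b] * (val w)⁻¹ = val [a, b, a, b, a, b]) :
    π w ∈ N := by
  have hne : b ≠ a := by
    intro h
    rw [h] at hab
    omega
  have hfar : ¬ Far a b ∧ ¬ Far b a := by unfold Far; omega
  obtain ⟨D, hD⟩ := exists_lift (n := n) (H := DihedralGroup 7)
    (fun y => if y = a then .sr 0 else if y = b then .sr 1 else 1)
    (by
      intro j
      split_ifs <;> simp)
    (by
      intro j k hjk
      split_ifs with h1 h2 h3 h2 h3 h4 <;> subst_vars <;> simp_all)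
  have hDa : D (gen a) = .sr 0 := by rw [hD, if_pos rfl]
  have hDb : D (gen b) = .sr 1 := by rw [hD, if_neg hne, if_pos rfl]
  have claim : ∀ w : List (Fin (n - 1)),
      (∀ y ∈ w, y = a ∨ y = b ∨ (Far y a ∧ Far y b)) →
      (∃ k, D (val w) = .r k ∧ π w ∈ N) ∨ (∃ k, D (val w) = .sr k ∧ s a * π w ∈ N) := by
    intro w
    induction w with
    | nil => exact fun _ => Or.inl ⟨0, by simp, by simp [π, one_mem]⟩
    | cons y w ih =>
      intro h
      have hpi : (π (y :: w) : Equiv.Perm (Fin n)) = s y * π w := by simp [π]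
      rw [hpi, val_cons, map_mul]
      rcases h y (by simp) with rfl | rfl | ⟨ha, hb⟩
      · rcases ih (fun z hz => h z (by simp [hz])) with ⟨k, h1, h2⟩ | ⟨k, h1, h2⟩
        · refine Or.inr ⟨k, by rw [h1, hDa]; simp, ?_⟩
          rw [← mul_assoc, s_sq, one_mul]; exact h2
        · exact Or.inl ⟨k - 0, by rw [h1, hDa, DihedralGroup.sr_mul_sr], h2⟩
      · rcases ih (fun z hz => h z (by simp [hz])) with ⟨k, h1, h2⟩ | ⟨k, h1, h2⟩
        · refine Or.inr ⟨1 + k, by rw [h1, hDb]; simp, ?_⟩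
          rw [← mul_assoc]; exact mul_mem hN h2
        · refine Or.inl ⟨k - 1, by rw [h1, hDb, DihedralGroup.sr_mul_sr], ?_⟩
          have h3 := mul_mem (inv_mem hN) h2
          rw [mul_inv_rev, inv_eq_of_mul_eq_one_left (s_sq y)] at h3
          simpa [mul_assoc] using h3
      · have hya : y ≠ a := by
          rintro rfl
          unfold Far at ha
          omega
        have hyb : y ≠ b := by
          rintro rfl
          unfold Far at hb
          omega
        have hDy : D (gen y) = 1 := by rw [hD, if_neg hya, if_neg hyb]
        rw [hDy, one_mul]
        rcases ih (fun z hz => h z (by simp [hz])) with ⟨k, h1, h2⟩ | ⟨k, h1, h2⟩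
        · exact Or.inl ⟨k, h1, mul_mem (hN2 y ha hb) h2⟩
        · refine Or.inr ⟨k, h1, ?_⟩
          rw [← mul_assoc, ← s_comm y a ha, mul_assoc]
          exact mul_mem (hN2 y ha hb) h2
  rcases claim w hP with ⟨k, h1, h2⟩ | ⟨k, h1, h2⟩
  · exact h2
  · exfalso
    have h3 := congrArg D hw
    simp only [map_mul, map_inv, h1, val_cons, val_nil, hDa, hDb, mul_one] at h3
    revert h3
    clear h1
    revert k
    decide

end RAC

/-- Theorem 5.2, full characterization: the primitive 6-cycles based at `σ`
and at `γ` with transpositions `s_i, s_{i+1}` are G-homotopic if and only if `σ⁻¹γ` lies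
in the subgroup generated by `s_i · s_{i+1}` together with all adjacent transpositions
`s_m` disjoint from `s_i` and `s_{i+1}` (those with `m ≤ i-2` or `m ≥ i+3`). -/
theorem wequiv_iff_mem_closure {n : ℕ} (hn : 2 ≤ n) (i : ℕ) (hi : i + 3 ≤ n)
    (σ γ : Equiv.Perm (Fin n)) :
    (∃ u v : List (Fin (n - 1)), π u = σ ∧ π v = γ ∧
        WEquiv (u ++ cword i hi ++ u.reverse) (v ++ cword i hi ++ v.reverse)) ↔
      σ⁻¹ * γ ∈ Subgroup.closure
        ({s ⟨i, by omega⟩ * s ⟨i + 1, by omega⟩} ∪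
          {g : Equiv.Perm (Fin n) |
            ∃ m : Fin (n - 1), (m.val + 2 ≤ i ∨ i + 3 ≤ m.val) ∧ g = s m}) := by
  constructor
  · rintro ⟨u, v, rfl, rfl, h⟩
    have hval := RAC.val_eq_of_wequiv h
    simp only [RAC.val_append, RAC.val_reverse] at hval
    classical
    let P : ℕ → Prop := fun L => ∃ w : List (Fin (n - 1)),
      RAC.val w = RAC.val (u.reverse ++ v) ∧ w.length = L
    have hP : ∃ L, P L := ⟨_, u.reverse ++ v, rfl, rfl⟩
    obtain ⟨w, hw, hwL⟩ := Nat.find_spec hP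
    have hmin : ∀ w', RAC.val w' = RAC.val w → w.length ≤ w'.length := by
      intro w' hw'
      rw [hwL]
      exact Nat.find_min' hP ⟨w', hw'.trans hw, rfl⟩
    have hcomm : RAC.val w * RAC.val (cword i hi) * (RAC.val w)⁻¹ = RAC.val (cword i hi) := by
      rw [hw, RAC.val_append, RAC.val_reverse]
      calc _ = (RAC.val u)⁻¹ * (RAC.val v * RAC.val (cword i hi) * (RAC.val v)⁻¹) * RAC.val u := by
            group
        _ = _ := by rw [← hval]; group
    obtain ⟨Q, hQ⟩ := RAC.exists_lift (n := n) (fun j => (s j : Equiv.Perm (Fin n)))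
      RAC.s_sq RAC.s_comm
    have hQv : ∀ w, Q (RAC.val w) = π w := by
      intro w
      induction w with
      | nil => simp [π]
      | cons y w ih => rw [RAC.val_cons, map_mul, hQ, ih]; simp [π]
    have hpi : (π u)⁻¹ * π v = π w := by
      rw [← hQv w, hw, hQv, RAC.pi_append, RAC.pi_reverse]
    rw [hpi]
    have hmem : ∀ x z : Fin (n - 1), (z.val = i ∨ z.val = i + 1) → x.val ≠ i → x.val ≠ i + 1 →
        ¬ RAC.Far z x → x ∉ w := by
      intro x z hz hx1 hx2 hzx
      refine RAC.not_mem_of_minimal hzx (c := RAC.val (cword i hi)) ?_ ?_ w hmin hcomm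
      · intro F hF
        rcases hz with hz | hz
        · simp only [cword, RAC.val_cons, RAC.val_nil, map_mul, hF, Fin.ext_iff, hz, map_one]
          simp
          decide
        · simp only [cword, RAC.val_cons, RAC.val_nil, map_mul, hF, Fin.ext_iff, hz, map_one]
          simp
          decide
      · refine ⟨cword i hi, ?_, rfl⟩
        simp [cword, Fin.ext_iff, hx1, hx2]
    refine RAC.forward ⟨i, by omega⟩ ⟨i + 1, by omega⟩ rfl w ?_ _ ?_ ?_ hcomm
    · intro y hy
      by_cases h1 : y.val = i
      · exact Or.inl (Fin.ext h1)
      by_cases h2 : y.val = i + 1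
      · exact Or.inr (Or.inl (Fin.ext h2))
      refine Or.inr (Or.inr ⟨?_, ?_⟩)
      · by_contra h3
        exact hmem y ⟨i, by omega⟩ (Or.inl rfl) h1 h2 (fun h => h3 (Or.symm h)) hy
      · by_contra h3
        exact hmem y ⟨i + 1, by omega⟩ (Or.inr rfl) h1 h2 (fun h => h3 (Or.symm h)) hy
    · exact Subgroup.subset_closure (Or.inl rfl)
    · intro m h1 h2
      refine Subgroup.subset_closure (Or.inr ⟨m, ?_, rfl⟩)
      simp only [RAC.Far] at h1 h2
      omega
  · intro h
    have key : ∃ w : List (Fin (n - 1)), π w = σ⁻¹ * γ ∧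
        WEquiv (w ++ cword i hi ++ w.reverse) (cword i hi) := by
      generalize σ⁻¹ * γ = τ at h
      induction h using Subgroup.closure_induction with
      | mem x hx =>
        rcases hx with hx | ⟨m, hm, rfl⟩
        · rw [Set.mem_singleton_iff] at hx
          subst hx
          refine ⟨[⟨i, by omega⟩, ⟨i + 1, by omega⟩], by simp [π], ?_⟩
          have h1 := RAC.wequiv_reverse_append [(⟨i, by omega⟩ : Fin (n - 1)), ⟨i + 1, by omega⟩]
          have h2 := RAC.wequiv_reverse_append [(⟨i + 1, by omega⟩ : Fin (n - 1)), ⟨i, by omega⟩]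
          have h3 := RAC.WEquiv.congr (cword i hi) [] h2
          simpa [cword] using h3
        · refine ⟨[m], by simp [π], ?_⟩
          apply RAC.wequiv_conj_comm
          intro y hy
          simp only [cword, List.mem_cons, List.not_mem_nil, or_false] at hy
          unfold RAC.Far
          rcases hy with rfl | rfl | rfl | rfl | rfl | rfl <;> simp only <;> omega
      | one => exact ⟨[], rfl, by simp only [List.nil_append, List.reverse_nil, List.append_nil]; exact Relation.EqvGen.refl _⟩
      | mul x y _ _ hx hy =>
        obtain ⟨v, hv, hv2⟩ := hx
        obtain ⟨w, hw, hw2⟩ := hy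
        refine ⟨v ++ w, by rw [RAC.pi_append, hv, hw], ?_⟩
        have h1 : WEquiv _ _ := (RAC.WEquiv.congr v v.reverse hw2).trans _ _ _ hv2
        simpa using h1
      | inv x _ hx =>
        obtain ⟨w, hw, hw2⟩ := hx
        refine ⟨w.reverse, by rw [RAC.pi_reverse, hw], ?_⟩
        have h1 := RAC.WEquiv.congr w.reverse w hw2
        have h2 := RAC.WEquiv.congr [] (cword i hi ++ (w.reverse ++ w))
          (RAC.wequiv_reverse_append w)
        have h3 := RAC.WEquiv.congr (cword i hi) [] (RAC.wequiv_reverse_append w)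
        simp only [List.nil_append, List.append_nil, List.append_assoc,
          List.reverse_reverse] at h1 h2 h3 ⊢
        exact Relation.EqvGen.trans _ _ _ (Relation.EqvGen.symm _ _ h1)
          (Relation.EqvGen.trans _ _ _ h2 h3)
    obtain ⟨w, hw, hw2⟩ := key
    obtain ⟨u, hu⟩ := RAC.exists_pi σ
    refine ⟨u, u ++ w, hu, by rw [RAC.pi_append, hu, hw]; simp, ?_⟩
    have h1 := RAC.WEquiv.congr u u.reverse hw2
    have h2 : WEquiv _ _ := Relation.EqvGen.symm _ _ h1
    simpa using h2
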